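/- Let φ(z) = |z|², R = ∂^k ∂̄^k and R*_φ ψ = e^{φ}∂^k∂̄^k(ψ e^{-φ}). Then for every ψ ∈ C_0^∞(ℂ), ⟨ψ, ∂̄^k(R*_φ ψ) − R*_φ(∂̄^k ψ)⟩_φ = Σ_{l=1}^{k} (k!)²/(l! ((k−l)!)²) · ⟨∂^k(∂̄^{k−l} ψ), ∂̄^{k−l} ψ⟩_φ. -/

import Mathlib

open MeasureTheory Complex Finset

noncomputable section

/-- Wirtinger derivative ∂ = (1/2)(∂/∂x − i ∂/∂y). -/
def dz (f : ℂ → ℂ) : ℂ → ℂ := fun z =>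
  (1/2 : ℂ) * (fderiv ℝ f z 1 - Complex.I * fderiv ℝ f z Complex.I)

/-- Wirtinger derivative ∂̄ = (1/2)(∂/∂x + i ∂/∂y). -/
def dzbar (f : ℂ → ℂ) : ℂ → ℂ := fun z =>
  (1/2 : ℂ) * (fderiv ℝ f z 1 + Complex.I * fderiv ℝ f z Complex.I)

/-- Weighted inner product ⟨f,g⟩_φ = ∫ conj f · g · e^{-φ}. -/
def wip (φ : ℂ → ℝ) (f g : ℂ → ℂ) : ℂ :=
  ∫ z : ℂ, (starRingEnd ℂ) (f z) * g z * (Real.exp (-(φ z)) : ℂ)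

/-- Weighted squared L² norm ‖f‖²_φ. -/
def wnorm (φ : ℂ → ℝ) (f : ℂ → ℂ) : ℝ :=
  ∫ z : ℂ, ‖f z‖ ^ 2 * Real.exp (-(φ z))

/-- Formal adjoint of ∂̄^k : ψ ↦ (−1)^k e^{φ} ∂^k(ψ e^{-φ}). -/
def dbarStar (k : ℕ) (φ : ℂ → ℝ) (ψ : ℂ → ℂ) : ℂ → ℂ := fun z =>
  (-1 : ℂ) ^ k * (Real.exp (φ z) : ℂ) *
    dz^[k] (fun w => ψ w * (Real.exp (-(φ w)) : ℂ)) z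

/-- Formal adjoint of ∂^k : ψ ↦ (−1)^k e^{φ} ∂̄^k(ψ e^{-φ}). -/
def dStar (k : ℕ) (φ : ℂ → ℝ) (ψ : ℂ → ℂ) : ℂ → ℂ := fun z =>
  (-1 : ℂ) ^ k * (Real.exp (φ z) : ℂ) *
    dzbar^[k] (fun w => ψ w * (Real.exp (-(φ w)) : ℂ)) z

/-- R = ∂^k ∂̄^k. -/
def Rop (k : ℕ) (ψ : ℂ → ℂ) : ℂ → ℂ := dz^[k] (dzbar^[k] ψ)

/-- Formal adjoint of R : ψ ↦ e^{φ} ∂^k ∂̄^k(ψ e^{-φ}). -/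
def RStar (k : ℕ) (φ : ℂ → ℝ) (ψ : ℂ → ℂ) : ℂ → ℂ := fun z =>
  (Real.exp (φ z) : ℂ) *
    dz^[k] (dzbar^[k] (fun w => ψ w * (Real.exp (-(φ w)) : ℂ))) z


open scoped ContDiff

def Tw (f : ℂ → ℂ) : ℂ → ℂ := fun z => dz f z - (starRingEnd ℂ) z * f z
def Sw (f : ℂ → ℂ) : ℂ → ℂ := fun z => dzbar f z - z * f z
def Ew : ℂ → ℂ := fun z => (Real.exp (-(Complex.normSq z)) : ℂ)

theorem dz_add {f g : ℂ → ℂ} {z : ℂ} (hf : DifferentiableAt ℝ f z) (hg : DifferentiableAt ℝ g z) :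
    dz (f + g) z = dz f z + dz g z := by
  simp only [dz, fderiv_add hf hg, _root_.add_apply]; ring

theorem dzbar_add {f g : ℂ → ℂ} {z : ℂ} (hf : DifferentiableAt ℝ f z)
    (hg : DifferentiableAt ℝ g z) :
    dzbar (f + g) z = dzbar f z + dzbar g z := by
  simp only [dzbar, fderiv_add hf hg, _root_.add_apply]; ring

theorem dz_sub {f g : ℂ → ℂ} {z : ℂ} (hf : DifferentiableAt ℝ f z) (hg : DifferentiableAt ℝ g z) :
    dz (fun w => f w - g w) z = dz f z - dz g z := by
  simp only [dz, fderiv_fun_sub hf hg, _root_.sub_apply]; ring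

theorem dzbar_sub {f g : ℂ → ℂ} {z : ℂ} (hf : DifferentiableAt ℝ f z)
    (hg : DifferentiableAt ℝ g z) :
    dzbar (fun w => f w - g w) z = dzbar f z - dzbar g z := by
  simp only [dzbar, fderiv_fun_sub hf hg, _root_.sub_apply]; ring

theorem dz_mul {f g : ℂ → ℂ} {z : ℂ} (hf : DifferentiableAt ℝ f z) (hg : DifferentiableAt ℝ g z) :
    dz (fun w => f w * g w) z = dz f z * g z + f z * dz g z := by
  simp only [dz, fderiv_fun_mul hf hg, _root_.add_apply, _root_.smul_apply, smul_eq_mul]; ring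

theorem dzbar_mul {f g : ℂ → ℂ} {z : ℂ} (hf : DifferentiableAt ℝ f z)
    (hg : DifferentiableAt ℝ g z) :
    dzbar (fun w => f w * g w) z = dzbar f z * g z + f z * dzbar g z := by
  simp only [dzbar, fderiv_fun_mul hf hg, _root_.add_apply, _root_.smul_apply, smul_eq_mul]; ring

theorem dzbar_id (z : ℂ) : dzbar (fun w => w) z = 0 := by
  simp [dzbar]

theorem hasFD_conj (z : ℂ) :
    HasFDerivAt (fun w : ℂ => (starRingEnd ℂ) w) (Complex.conjCLE : ℂ →L[ℝ] ℂ) z :=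
  Complex.conjCLE.hasFDerivAt

theorem dzbar_conj (z : ℂ) : dzbar (fun w => (starRingEnd ℂ) w) z = 1 := by
  simp only [dzbar, (hasFD_conj z).fderiv]
  simp
  norm_num

theorem conj_contDiff : ContDiff ℝ ∞ (fun w : ℂ => (starRingEnd ℂ) w) :=
  Complex.conjCLE.contDiff

theorem Ew_eq : Ew = fun z => Complex.exp (-(z * (starRingEnd ℂ) z)) := by
  funext z
  simp [Ew, Complex.mul_conj]

theorem Ew_contDiff : ContDiff ℝ ∞ Ew := by
  rw [Ew_eq]
  exact (contDiff_id.mul conj_contDiff).neg.cexp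

theorem Ew_hasFD (z : ℂ) : HasFDerivAt Ew (Complex.exp (-(z * (starRingEnd ℂ) z)) •
    (-(z • (Complex.conjCLE : ℂ →L[ℝ] ℂ) + (starRingEnd ℂ) z • ContinuousLinearMap.id ℝ ℂ))) z := by
  rw [Ew_eq]
  exact ((hasFDerivAt_id z).mul (hasFD_conj z)).neg.cexp

theorem dz_Ew (z : ℂ) : dz Ew z = -((starRingEnd ℂ) z * Ew z) := by
  have h : Ew z = Complex.exp (-(z * (starRingEnd ℂ) z)) := by rw [Ew_eq]
  simp only [dz, (Ew_hasFD z).fderiv, h]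
  simp
  linear_combination (1/2 * Complex.exp (-(z * (starRingEnd ℂ) z)) *
    ((starRingEnd ℂ) z - z)) * Complex.I_sq

theorem dzbar_Ew (z : ℂ) : dzbar Ew z = -(z * Ew z) := by
  have h : Ew z = Complex.exp (-(z * (starRingEnd ℂ) z)) := by rw [Ew_eq]
  simp only [dzbar, (Ew_hasFD z).fderiv, h]
  simp
  linear_combination (-1/2 * Complex.exp (-(z * (starRingEnd ℂ) z)) *
    ((starRingEnd ℂ) z - z)) * Complex.I_sq

theorem contDiff_fd {f : ℂ → ℂ} (hf : ContDiff ℝ ∞ f) (v : ℂ) :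
    ContDiff ℝ ∞ (fun z => fderiv ℝ f z v) :=
  (hf.fderiv_right (m := ∞) (by simp)).clm_apply contDiff_const

theorem contDiff_dz {f : ℂ → ℂ} (hf : ContDiff ℝ ∞ f) : ContDiff ℝ ∞ (dz f) :=
  contDiff_const.mul ((contDiff_fd hf 1).sub (contDiff_const.mul (contDiff_fd hf I)))

theorem contDiff_dzbar {f : ℂ → ℂ} (hf : ContDiff ℝ ∞ f) : ContDiff ℝ ∞ (dzbar f) :=
  contDiff_const.mul ((contDiff_fd hf 1).add (contDiff_const.mul (contDiff_fd hf I)))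

theorem hcs_dz {f : ℂ → ℂ} (hf : HasCompactSupport f) : HasCompactSupport (dz f) :=
  ((hf.fderiv_apply (𝕜 := ℝ) 1).sub (hf.fderiv_apply (𝕜 := ℝ) I).mul_left).mul_left

theorem hcs_dzbar {f : ℂ → ℂ} (hf : HasCompactSupport f) : HasCompactSupport (dzbar f) :=
  ((hf.fderiv_apply (𝕜 := ℝ) 1).add (hf.fderiv_apply (𝕜 := ℝ) I).mul_left).mul_left

theorem diffAt {f : ℂ → ℂ} (hf : ContDiff ℝ ∞ f) (z : ℂ) : DifferentiableAt ℝ f z :=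
  (hf.differentiable (by simp)) z

theorem fd_fd {f : ℂ → ℂ} (hf : ContDiff ℝ ∞ f) (v w z : ℂ) :
    fderiv ℝ (fun z => fderiv ℝ f z v) z w = fderiv ℝ (fderiv ℝ f) z w v := by
  have h : DifferentiableAt ℝ (fderiv ℝ f) z :=
    (hf.fderiv_right (m := ∞) (by simp)).differentiable (by simp) z
  rw [fderiv_clm_apply h (differentiableAt_const v)]
  simp

theorem fd_dz {f : ℂ → ℂ} (hf : ContDiff ℝ ∞ f) (z w : ℂ) :
    fderiv ℝ (dz f) z w = (1/2 : ℂ) * (fderiv ℝ (fderiv ℝ f) z w 1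
      - I * fderiv ℝ (fderiv ℝ f) z w I) := by
  have h1 := diffAt (contDiff_fd hf 1) z
  have hI := diffAt (contDiff_fd hf I) z
  have : dz f = fun z => (1/2 : ℂ) * (fderiv ℝ f z 1 - I * fderiv ℝ f z I) := rfl
  rw [this, fderiv_const_mul (h1.fun_sub (hI.const_mul I)), fderiv_fun_sub h1 (hI.const_mul I),
    fderiv_const_mul hI]
  simp [fd_fd hf]
  try ring

theorem fd_dzbar {f : ℂ → ℂ} (hf : ContDiff ℝ ∞ f) (z w : ℂ) :
    fderiv ℝ (dzbar f) z w = (1/2 : ℂ) * (fderiv ℝ (fderiv ℝ f) z w 1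
      + I * fderiv ℝ (fderiv ℝ f) z w I) := by
  have h1 := diffAt (contDiff_fd hf 1) z
  have hI := diffAt (contDiff_fd hf I) z
  have : dzbar f = fun z => (1/2 : ℂ) * (fderiv ℝ f z 1 + I * fderiv ℝ f z I) := rfl
  rw [this, fderiv_const_mul (h1.fun_add (hI.const_mul I)), fderiv_fun_add h1 (hI.const_mul I),
    fderiv_const_mul hI]
  simp [fd_fd hf]
  try ring

theorem dz_dzbar {f : ℂ → ℂ} (hf : ContDiff ℝ ∞ f) : dzbar (dz f) = dz (dzbar f) := by
  funext z
  have hs : IsSymmSndFDerivAt ℝ f z :=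
    hf.contDiffAt.isSymmSndFDerivAt (by
      rw [minSmoothness_of_isRCLikeNormedField]
      exact WithTop.coe_le_coe.2 (le_top : (2 : ℕ∞) ≤ ⊤))
  have h := hs.eq 1 I
  rw [dz, dzbar]
  simp only [fd_dz hf, fd_dzbar hf, h]
  ring

/-- Test functions. -/
def Vt : Submodule ℂ (ℂ → ℂ) where
  carrier := {f | ContDiff ℝ ∞ f ∧ HasCompactSupport f}
  add_mem' := fun ha hb => ⟨ha.1.add hb.1, ha.2.add hb.2⟩
  zero_mem' := ⟨contDiff_const, HasCompactSupport.zero⟩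
  smul_mem' := fun _ _ hf => ⟨contDiff_const.smul hf.1, hf.2.smul_left⟩

theorem dz_smul {f : ℂ → ℂ} (c : ℂ) (hf : ContDiff ℝ ∞ f) (z : ℂ) :
    dz (c • f) z = c * dz f z := by
  simp only [dz, fderiv_const_smul (diffAt hf z), _root_.smul_apply, smul_eq_mul]; ring

theorem dzbar_smul {f : ℂ → ℂ} (c : ℂ) (hf : ContDiff ℝ ∞ f) (z : ℂ) :
    dzbar (c • f) z = c * dzbar f z := by
  simp only [dzbar, fderiv_const_smul (diffAt hf z), _root_.smul_apply, smul_eq_mul]; ring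

theorem Tw_mem {f : ℂ → ℂ} (hf : f ∈ Vt) : Tw f ∈ Vt :=
  ⟨(contDiff_dz hf.1).sub (conj_contDiff.mul hf.1), (hcs_dz hf.2).sub hf.2.mul_left⟩

theorem Sw_mem {f : ℂ → ℂ} (hf : f ∈ Vt) : Sw f ∈ Vt :=
  ⟨(contDiff_dzbar hf.1).sub (contDiff_id.mul hf.1), (hcs_dzbar hf.2).sub hf.2.mul_left⟩

def Pop : Module.End ℂ Vt where
  toFun f := ⟨dz f.1, contDiff_dz f.2.1, hcs_dz f.2.2⟩
  map_add' f g := Subtype.ext (funext fun z => dz_add (diffAt f.2.1 z) (diffAt g.2.1 z))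
  map_smul' c f := Subtype.ext (funext fun z => dz_smul c f.2.1 z)

def Dop : Module.End ℂ Vt where
  toFun f := ⟨dzbar f.1, contDiff_dzbar f.2.1, hcs_dzbar f.2.2⟩
  map_add' f g := Subtype.ext (funext fun z => dzbar_add (diffAt f.2.1 z) (diffAt g.2.1 z))
  map_smul' c f := Subtype.ext (funext fun z => dzbar_smul c f.2.1 z)

def Tpo : Module.End ℂ Vt where
  toFun f := ⟨Tw f.1, Tw_mem f.2⟩
  map_add' f g := Subtype.ext (funext fun z => by
    have := dz_add (diffAt f.2.1 z) (diffAt g.2.1 z)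
    simp [Tw, this]; ring)
  map_smul' c f := Subtype.ext (funext fun z => by
    have := dz_smul c f.2.1 z
    simp [Tw, this]; ring)

def Sop : Module.End ℂ Vt where
  toFun f := ⟨Sw f.1, Sw_mem f.2⟩
  map_add' f g := Subtype.ext (funext fun z => by
    have := dzbar_add (diffAt f.2.1 z) (diffAt g.2.1 z)
    simp [Sw, this]; ring)
  map_smul' c f := Subtype.ext (funext fun z => by
    have := dzbar_smul c f.2.1 z
    simp [Sw, this]; ring)

theorem Pop_pow (n : ℕ) (f : Vt) : ((Pop ^ n) f).1 = dz^[n] f.1 := by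
  induction n with
  | zero => rfl
  | succ n ih => rw [pow_succ', Function.iterate_succ_apply', ← ih]; rfl

theorem Dop_pow (n : ℕ) (f : Vt) : ((Dop ^ n) f).1 = dzbar^[n] f.1 := by
  induction n with
  | zero => rfl
  | succ n ih => rw [pow_succ', Function.iterate_succ_apply', ← ih]; rfl

theorem dz_mul_Ew (f : Vt) : dz (fun w => f.1 w * Ew w) = fun w => (Tpo f).1 w * Ew w := by
  funext z
  rw [dz_mul (diffAt f.2.1 z) (diffAt Ew_contDiff z), dz_Ew]
  simp only [Tpo, Tw, LinearMap.coe_mk, AddHom.coe_mk]; ring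

theorem dzbar_mul_Ew (f : Vt) : dzbar (fun w => f.1 w * Ew w) = fun w => (Sop f).1 w * Ew w := by
  funext z
  rw [dzbar_mul (diffAt f.2.1 z) (diffAt Ew_contDiff z), dzbar_Ew]
  simp only [Sop, Sw, LinearMap.coe_mk, AddHom.coe_mk]; ring

theorem dz_iter_mul_Ew (n : ℕ) (f : Vt) :
    dz^[n] (fun w => f.1 w * Ew w) = fun w => ((Tpo ^ n) f).1 w * Ew w := by
  induction n with
  | zero => rfl
  | succ n ih => rw [pow_succ', Function.iterate_succ_apply', ih, dz_mul_Ew]; rfl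

theorem dzbar_iter_mul_Ew (n : ℕ) (f : Vt) :
    dzbar^[n] (fun w => f.1 w * Ew w) = fun w => ((Sop ^ n) f).1 w * Ew w := by
  induction n with
  | zero => rfl
  | succ n ih => rw [pow_succ', Function.iterate_succ_apply', ih, dzbar_mul_Ew]; rfl

theorem RStar_eq (k : ℕ) (f : Vt) :
    RStar k (fun z => Complex.normSq z) f.1 = ((Tpo ^ k) ((Sop ^ k) f)).1 := by
  funext z
  have h1 := dzbar_iter_mul_Ew k f
  have h2 := dz_iter_mul_Ew k ((Sop ^ k) f)
  unfold RStar
  change _ * dz^[k] (dzbar^[k] (fun w => f.1 w * Ew w)) z = _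
  rw [h1, h2]
  simp only [Ew]
  rw [mul_left_comm, ← Complex.ofReal_mul, ← Real.exp_add]
  simp

theorem comm_DT : Dop * Tpo = Tpo * Dop - 1 := by
  ext f z
  have h : dzbar (Tw f.1) z = _ := dzbar_sub (diffAt (contDiff_dz f.2.1) z)
    (diffAt (conj_contDiff.mul f.2.1) z)
  rw [dzbar_mul (diffAt conj_contDiff z) (diffAt f.2.1 z), dzbar_conj, dz_dzbar f.2.1] at h
  change dzbar (Tw f.1) z = Tw (dzbar f.1) z - f.1 z
  rw [h, Tw]; ring

theorem comm_DS : Commute Dop Sop := by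
  ext f z
  have h : dzbar (Sw f.1) z = _ := dzbar_sub (diffAt (contDiff_dzbar f.2.1) z)
    (diffAt (contDiff_id.mul f.2.1) z)
  have h' : dzbar (fun w => w * f.1 w) z = _ := dzbar_mul differentiableAt_id (diffAt f.2.1 z)
  rw [dzbar_id] at h'
  change dzbar (Sw f.1) z = Sw (dzbar f.1) z
  rw [h, Sw]
  rw [h']; ring

section alg
variable {A : Type*} [Ring A]

theorem alg1 (D T : A) (h : D * T = T * D - 1) (m : ℕ) :
    D * T ^ m = T ^ m * D - (m : A) * T ^ (m - 1) := by
  induction m with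
  | zero => simp
  | succ m ih =>
    rw [pow_succ', ← mul_assoc, h, sub_mul, mul_assoc, ih]
    rcases m with _ | m
    · simp
    · have := (Nat.cast_commute (m + 1) T).eq
      simp only [mul_sub, ← mul_assoc, Nat.add_sub_cancel, one_mul]
      rw [← this]
      simp only [mul_assoc, ← pow_succ']
      push_cast
      noncomm_ring

theorem alg2 (D T : A) (h : D * T = T * D - 1) (n m : ℕ) :
    D ^ n * T ^ m = ∑ j ∈ range (n + 1),
      (((-1) ^ j * (n.choose j * m.descFactorial j : ℕ) : ℤ) : A) * (T ^ (m - j) * D ^ (n - j)) := by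
  induction n generalizing m with
  | zero => simp
  | succ n ih =>
    have e1 : D ^ (n + 1) * T ^ m = (D ^ n * T ^ m) * D - (m : A) * (D ^ n * T ^ (m - 1)) := by
      rw [pow_succ, mul_assoc, alg1 D T h, mul_sub, ← mul_assoc, ← mul_assoc, ← mul_assoc,
        (Nat.cast_commute m (D ^ n)).eq]
    rw [e1, ih, ih, sum_range_succ' _ (n + 1)]
    have e2 : ∀ j ∈ range (n + 1),
        ((((-1) ^ (j + 1) * ((n + 1).choose (j + 1) * m.descFactorial (j + 1) : ℕ) : ℤ) : A)
          * (T ^ (m - (j + 1)) * D ^ (n + 1 - (j + 1))))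
        = (((-1) ^ (j + 1) * (n.choose (j + 1) * m.descFactorial (j + 1) : ℕ) : ℤ) : A)
          * (T ^ (m - (j + 1)) * D ^ (n - j))
        - (m : A) * ((((-1) ^ j * (n.choose j * (m - 1).descFactorial j : ℕ) : ℤ) : A)
          * (T ^ (m - 1 - j) * D ^ (n - j))) := by
      intro j _
      have hm : m.descFactorial (j + 1) = m * (m - 1).descFactorial j := by
        rcases m with _ | m
        · simp
        · rw [Nat.succ_descFactorial_succ, Nat.add_sub_cancel]
      rw [Nat.choose_succ_succ, hm, Nat.add_sub_add_right, show m - (j + 1) = m - 1 - j by omega,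
        ← mul_assoc (m : A), ← sub_mul]
      congr 1
      have : (m : A) = ((m : ℤ) : A) := by simp
      rw [this, ← Int.cast_mul, ← Int.cast_sub]
      congr 1
      push_cast
      ring
    rw [sum_congr rfl e2, sum_sub_distrib, ← mul_sum, sub_add_eq_add_sub]
    congr 1
    rw [sum_range_succ' _ n, sum_range_succ _ n, add_mul, sum_mul]
    simp only [mul_assoc, ← pow_succ]
    simp only [Nat.choose_succ_self, zero_mul, Nat.cast_zero, mul_zero, Int.cast_zero, add_zero,
      Nat.choose_zero_right, Nat.sub_zero]
    congr 1
    refine sum_congr rfl fun j hj => ?_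
    rw [show n - (j + 1) + 1 = n - j by have := mem_range.1 hj; omega]

end alg

theorem integrable_Vt {f : ℂ → ℂ} (hf : f ∈ Vt) : Integrable f :=
  hf.1.continuous.integrable_of_hasCompactSupport hf.2

theorem mul_mem {f g : ℂ → ℂ} (hf : ContDiff ℝ ∞ f) (hg : g ∈ Vt) : (fun z => f z * g z) ∈ Vt :=
  ⟨hf.mul hg.1, hg.2.mul_left⟩

theorem conj_mem {f : ℂ → ℂ} (hf : f ∈ Vt) : (fun z => (starRingEnd ℂ) (f z)) ∈ Vt :=
  ⟨conj_contDiff.comp hf.1, hf.2.comp_left (map_zero _)⟩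

theorem fd_conj {f : ℂ → ℂ} (hf : f ∈ Vt) (z v : ℂ) :
    fderiv ℝ (fun z => (starRingEnd ℂ) (f z)) z v = (starRingEnd ℂ) (fderiv ℝ f z v) := by
  have := ((hasFD_conj (f z)).comp z (diffAt hf.1 z).hasFDerivAt).fderiv
  change fderiv ℝ ((fun w => (starRingEnd ℂ) w) ∘ f) z v = _
  rw [this]; simp

theorem dz_conj' {f : ℂ → ℂ} (hf : f ∈ Vt) (z : ℂ) :
    dz (fun z => (starRingEnd ℂ) (f z)) z = (starRingEnd ℂ) (dzbar f z) := by
  have h2 : (starRingEnd ℂ) (1 / 2 : ℂ) = 1 / 2 := by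
    rw [map_div₀, map_one, Complex.conj_ofNat]
  simp only [dz, dzbar, fd_conj hf, map_mul, map_add, map_sub, h2, Complex.conj_I]
  ring

theorem dzbar_conj' {f : ℂ → ℂ} (hf : f ∈ Vt) (z : ℂ) :
    dzbar (fun z => (starRingEnd ℂ) (f z)) z = (starRingEnd ℂ) (dz f z) := by
  have h2 : (starRingEnd ℂ) (1 / 2 : ℂ) = 1 / 2 := by
    rw [map_div₀, map_one, Complex.conj_ofNat]
  simp only [dz, dzbar, fd_conj hf, map_mul, map_add, map_sub, h2, Complex.conj_I]
  ring

theorem fd_mem {f : ℂ → ℂ} (hf : f ∈ Vt) (v : ℂ) : (fun z => fderiv ℝ f z v) ∈ Vt :=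
  ⟨contDiff_fd hf.1 v, hf.2.fderiv_apply (𝕜 := ℝ) v⟩

theorem int_fd {f : ℂ → ℂ} (hf : f ∈ Vt) (v : ℂ) : ∫ z, fderiv ℝ f z v = 0 := by
  have := integral_smul_fderiv_eq_neg_fderiv_smul_of_integrable (μ := volume) (𝕜 := ℝ)
    (f := fun _ : ℂ => (1 : ℝ)) (g := f) (v := v) (by simp)
    (by simpa using integrable_Vt (fd_mem hf v)) (by simpa using integrable_Vt hf)
    (fun x _ => differentiableAt_const _) (fun x _ => diffAt hf.1 x)
  simpa using this

theorem int_dz {f : ℂ → ℂ} (hf : f ∈ Vt) : ∫ z, dz f z = 0 := by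
  simp only [dz]
  rw [integral_const_mul, integral_sub (integrable_Vt (fd_mem hf 1))
    ((integrable_Vt (fd_mem hf I)).const_mul I), integral_const_mul, int_fd hf, int_fd hf]
  simp

theorem int_dzbar {f : ℂ → ℂ} (hf : f ∈ Vt) : ∫ z, dzbar f z = 0 := by
  simp only [dzbar]
  rw [integral_const_mul, integral_add (integrable_Vt (fd_mem hf 1))
    ((integrable_Vt (fd_mem hf I)).const_mul I), integral_const_mul, int_fd hf, int_fd hf]
  simp

def wf (f g : Vt) : ℂ := wip (fun z => Complex.normSq z) f.1 g.1

theorem wf_int (f g : Vt) : Integrable (fun z => (starRingEnd ℂ) (f.1 z) * g.1 z * Ew z) := by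
  have h := mul_mem Ew_contDiff (mul_mem (conj_mem f.2).1 g.2)
  have := integrable_Vt h
  simpa only [mul_comm] using this

theorem wf_eq (f g : Vt) : wf f g = ∫ z, (starRingEnd ℂ) (f.1 z) * g.1 z * Ew z := rfl

def wL (f : Vt) : Vt →ₗ[ℂ] ℂ where
  toFun g := wf f g
  map_add' g h := by
    simp only [wf_eq]
    rw [← integral_add (wf_int f g) (wf_int f h)]
    congr 1; funext z; simp; ring
  map_smul' c g := by
    simp only [wf_eq]
    rw [RingHom.id_apply, smul_eq_mul, ← integral_const_mul]
    congr 1; funext z; simp; ring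

theorem adjT (f g : Vt) : wf f (Tpo g) = - wf (Dop f) g := by
  rw [eq_neg_iff_add_eq_zero]
  simp only [wf_eq]
  rw [← integral_add (wf_int _ _) (wf_int _ _)]
  have hm : (fun z => (starRingEnd ℂ) (f.1 z) * (g.1 z * Ew z)) ∈ Vt := by
    have := mul_mem (conj_mem f.2).1 (mul_mem Ew_contDiff g.2)
    simpa only [mul_comm (Ew _)] using this
  rw [← int_dz hm]
  congr 1; funext z
  rw [dz_mul (diffAt (conj_mem f.2).1 z) (diffAt (g.2.1.mul Ew_contDiff) z), dz_mul_Ew,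
    dz_conj' f.2]
  simp only [Dop, LinearMap.coe_mk, AddHom.coe_mk]; ring

theorem adjS (f g : Vt) : wf f (Sop g) = - wf (Pop f) g := by
  rw [eq_neg_iff_add_eq_zero]
  simp only [wf_eq]
  rw [← integral_add (wf_int _ _) (wf_int _ _)]
  have hm : (fun z => (starRingEnd ℂ) (f.1 z) * (g.1 z * Ew z)) ∈ Vt := by
    have := mul_mem (conj_mem f.2).1 (mul_mem Ew_contDiff g.2)
    simpa only [mul_comm (Ew _)] using this
  rw [← int_dzbar hm]
  congr 1; funext z
  rw [dzbar_mul (diffAt (conj_mem f.2).1 z) (diffAt (g.2.1.mul Ew_contDiff) z), dzbar_mul_Ew,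
    dzbar_conj' f.2]
  simp only [Pop, LinearMap.coe_mk, AddHom.coe_mk]; ring

theorem adjT_pow (n : ℕ) (f g : Vt) : wf f ((Tpo ^ n) g) = (-1) ^ n * wf ((Dop ^ n) f) g := by
  induction n generalizing f with
  | zero => simp
  | succ n ih =>
    rw [pow_succ' Tpo, pow_succ Dop, Module.End.mul_apply, Module.End.mul_apply, adjT, ih]; ring

theorem adjS_pow (n : ℕ) (f g : Vt) : wf f ((Sop ^ n) g) = (-1) ^ n * wf ((Pop ^ n) f) g := by
  induction n generalizing f with
  | zero => simp
  | succ n ih =>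
    rw [pow_succ' Sop, pow_succ Pop, Module.End.mul_apply, Module.End.mul_apply, adjS, ih]; ring

theorem op_identity (k : ℕ) : Dop ^ k * (Tpo ^ k * Sop ^ k) - Tpo ^ k * Sop ^ k * Dop ^ k =
    ∑ l ∈ Icc 1 k, (((-1) ^ l * (k.choose l * k.descFactorial l : ℕ) : ℤ) : Module.End ℂ Vt) *
      (Tpo ^ (k - l) * (Sop ^ k * Dop ^ (k - l))) := by
  have hc : ∀ n, Dop ^ n * Sop ^ k = Sop ^ k * Dop ^ n := fun n => (comm_DS.pow_pow n k).eq
  rw [← mul_assoc, alg2 Dop Tpo comm_DT, sum_range_succ', add_mul, sum_mul]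
  have : Icc 1 k = Ico (0 + 1) (k + 1) := by ext; simp
  rw [this, ← sum_Ico_add', ← range_eq_Ico]
  simp only [mul_assoc, hc]
  simp
  abel

theorem coef (k l : ℕ) (h : l ≤ k) : ((k.choose l * k.descFactorial l : ℕ) : ℂ) =
    (k.factorial : ℂ) ^ 2 / ((l.factorial : ℂ) * ((k - l).factorial : ℂ) ^ 2) := by
  have h1 := Nat.choose_mul_factorial_mul_factorial h
  have h2 := Nat.factorial_mul_descFactorial h
  have hl : (l.factorial : ℂ) ≠ 0 := by exact_mod_cast l.factorial_ne_zero
  have hkl : ((k - l).factorial : ℂ) ≠ 0 := by exact_mod_cast (k - l).factorial_ne_zero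
  rw [eq_div_iff (by positivity), sq, sq]
  nth_rewrite 1 [← h1]
  rw [← h2]
  push_cast
  ring

theorem comm_dzbar_RStar (k : ℕ) (hk : 1 ≤ k) (ψ : ℂ → ℂ)
    (hψ : ContDiff ℝ (⊤ : ℕ∞) ψ) (hψc : HasCompactSupport ψ) :
    wip (fun z => Complex.normSq z) ψ
        (fun z => dzbar^[k] (RStar k (fun z => Complex.normSq z) ψ) z - RStar k (fun z => Complex.normSq z) (dzbar^[k] ψ) z)
      = ∑ l ∈ Finset.Icc 1 k,
          (((k.factorial : ℝ) ^ 2 / ((l.factorial : ℝ) * ((k - l).factorial : ℝ) ^ 2)) : ℂ) *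
            wip (fun z => Complex.normSq z) (dz^[k] (dzbar^[k - l] ψ)) (dzbar^[k - l] ψ) := by
  have hm : ψ ∈ Vt := ⟨hψ, hψc⟩
  obtain ⟨p, rfl⟩ : ∃ p : Vt, p.1 = ψ := ⟨⟨ψ, hm⟩, rfl⟩
  have e : (fun z => dzbar^[k] (RStar k (fun z => Complex.normSq z) p.1) z
      - RStar k (fun z => Complex.normSq z) (dzbar^[k] p.1) z)
      = ((Dop ^ k * (Tpo ^ k * Sop ^ k) - Tpo ^ k * Sop ^ k * Dop ^ k) p).1 := by
    rw [← Dop_pow k p, RStar_eq, RStar_eq, ← Dop_pow]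
    rfl
  rw [e, op_identity]
  change wL p _ = _
  rw [LinearMap.sum_apply, map_sum]
  refine sum_congr rfl fun l hl => ?_
  have hlk : l ≤ k := (mem_Icc.1 hl).2
  rw [← Dop_pow, ← Pop_pow, Module.End.mul_apply, Module.End.intCast_apply, map_zsmul]
  change _ • wf p ((Tpo ^ (k - l)) ((Sop ^ k) ((Dop ^ (k - l)) p))) = _ * wf _ _
  rw [adjT_pow, adjS_pow, zsmul_eq_mul]
  have := coef k l hlk
  simp only [Complex.ofReal_natCast]
  rw [← this]
  have hs : ((-1 : ℂ)) ^ l * ((-1) ^ (k - l) * (-1) ^ k) = 1 := by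
    rw [← mul_assoc, ← pow_add, Nat.add_sub_cancel' hlk, ← mul_pow]; simp
  push_cast
  linear_combination ((k.choose l : ℂ) * (k.descFactorial l : ℂ) *
    wf ((Pop ^ k) ((Dop ^ (k - l)) p)) ((Dop ^ (k - l)) p)) * hs


end
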